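/- arXiv:1709.08701 — 4 statements merged into one kernel-verified Lean document; each statement's English description precedes it below -/
import Mathlib

section
/- Let m be a monomial in k[x_1,…,x_{2n+1}] with an optimal factorization m = x_1^{a_1}⋯x_{2n+1}^{a_{2n+1}} e_1^{b_1}⋯e_{2n+1}^{b_{2n+1}} (so Σ_j b_j = b(m)). If integers a'_i and b'_j satisfy 0 ≤ a'_i ≤ a_i and 0 ≤ b'_j ≤ b_j for all i, j, then the factorization m' = x_1^{a'_1}⋯x_{2n+1}^{a'_{2n+1}} e_1^{b'_1}⋯e_{2n+1}^{b'_{2n+1}} is an optimal factorization of the monomial m', i.e., b(m') = Σ_j b'_j. -/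
open MvPolynomial

noncomputable section

/-- The ideal generated by the variables indexed by `S`. -/
def varIdeal (K : Type*) [Field K] (N : ℕ) (S : Finset (Fin N)) :
    Ideal (MvPolynomial (Fin N) K) :=
  Ideal.span ((fun i => (X i : MvPolynomial (Fin N) K)) '' S)

/-- The edge ideal of a graph `G`, generated by `X i * X j` for edges `{i, j}`. -/
def edgeIdeal (K : Type*) [Field K] {N : ℕ} (G : SimpleGraph (Fin N)) :
    Ideal (MvPolynomial (Fin N) K) :=
  Ideal.span {p | ∃ i j, G.Adj i j ∧ p = X i * X j}

/-- `S` is a vertex cover of `G`: every edge meets `S`. -/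
def IsVertexCover {N : ℕ} (G : SimpleGraph (Fin N)) (S : Finset (Fin N)) : Prop :=
  ∀ ⦃i j : Fin N⦄, G.Adj i j → i ∈ S ∨ j ∈ S

/-- `S` is a minimal vertex cover of `G`. -/
def IsMinVertexCover {N : ℕ} (G : SimpleGraph (Fin N)) (S : Finset (Fin N)) : Prop :=
  IsVertexCover G S ∧ ∀ T ⊂ S, ¬ IsVertexCover G T

/-- The `t`-th symbolic power of the edge ideal of `G`:
the intersection of the `t`-th powers of the minimal vertex cover primes. -/
def symbolicPower (K : Type*) [Field K] {N : ℕ} (G : SimpleGraph (Fin N)) (t : ℕ) :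
    Ideal (MvPolynomial (Fin N) K) :=
  ⨅ (S : Finset (Fin N)) (_ : IsMinVertexCover G S), varIdeal K N S ^ t

/-- The cycle graph on `Fin m`, with edges `{i, i+1 mod m}`. -/
def cycleGraph (m : ℕ) : SimpleGraph (Fin m) :=
  SimpleGraph.fromRel (fun i j => (j : ℕ) = ((i : ℕ) + 1) % m)

/-- The set `L(t)` of monomials of degree at least `2t` whose weight with respect to every
minimal vertex cover is at least `t`. -/
def Lset (K : Type*) [Field K] {N : ℕ} (G : SimpleGraph (Fin N)) (t : ℕ) :
    Set (MvPolynomial (Fin N) K) :=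
  {p | ∃ a : Fin N →₀ ℕ, p = monomial a 1 ∧ 2 * t ≤ ∑ i, a i ∧
    ∀ S : Finset (Fin N), IsMinVertexCover G S → t ≤ ∑ i ∈ S, a i}

/-- The set `D(t)` of monomials of degree less than `2t` whose weight with respect to every
minimal vertex cover is at least `t`. -/
def Dset (K : Type*) [Field K] {N : ℕ} (G : SimpleGraph (Fin N)) (t : ℕ) :
    Set (MvPolynomial (Fin N) K) :=
  {p | ∃ a : Fin N →₀ ℕ, p = monomial a 1 ∧ (∑ i, a i) < 2 * t ∧
    ∀ S : Finset (Fin N), IsMinVertexCover G S → t ≤ ∑ i ∈ S, a i}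

/-- `α(J)`: the least total degree of a nonzero polynomial in `J`. -/
def alphaDeg {K : Type*} [Field K] {N : ℕ} (J : Ideal (MvPolynomial (Fin N) K)) : ℕ :=
  sInf {d | ∃ f ∈ J, f ≠ 0 ∧ f.totalDegree = d}

/-- The symbolic defect: the minimal number of generators one must add to `I(G)^t`
to obtain the symbolic power `I(G)^(t)`. -/
def sdefect (K : Type*) [Field K] {N : ℕ} (G : SimpleGraph (Fin N)) (t : ℕ) : ℕ :=
  sInf {c | ∃ F : Finset (MvPolynomial (Fin N) K), F.card = c ∧
    symbolicPower K G t = edgeIdeal K G ^ t + Ideal.span (F : Set (MvPolynomial (Fin N) K))}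

/-- The graph consisting of the odd cycle on vertices `0, …, 2n` (that is,
`x_1, …, x_{2n+1}`) together with one extra vertex `2n+1` (that is, `x_{2n+2}`)
joined to vertex `0` (that is, `x_1`) by an edge. -/
def appendedCycle (n : ℕ) : SimpleGraph (Fin (2 * n + 2)) :=
  SimpleGraph.fromRel (fun i j =>
    ((j : ℕ) = (i : ℕ) + 1 ∧ (j : ℕ) ≤ 2 * n) ∨
    ((i : ℕ) = 2 * n ∧ (j : ℕ) = 0) ∨
    ((i : ℕ) = 0 ∧ (j : ℕ) = 2 * n + 1))

/-- The factorization of a monomial on the odd cycle `C_{2n+1}` given by ancillary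
exponents `a` and edge exponents `b` (edge `e_j = x_j x_{j+1}`, indices mod `2n+1`,
so that the exponent of `x_i` is `a i + b i + b (i-1)`) is optimal: no factorization
of the same monomial uses strictly more edges. -/
def IsOptimalFactorization (n : ℕ) (a b : Fin (2 * n + 1) → ℕ) : Prop :=
  ∀ a' b' : Fin (2 * n + 1) → ℕ,
    (∀ i, a i + b i + b (i - 1) = a' i + b' i + b' (i - 1)) →
    ∑ j, b' j ≤ ∑ j, b j

/-- If `m = ∏ x_i^{a_i} ∏ e_j^{b_j}` is an optimal factorization and `a' ≤ a`,
`b' ≤ b` componentwise, then `m' = ∏ x_i^{a'_i} ∏ e_j^{b'_j}` is an optimal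
factorization of the monomial it defines. -/
theorem isOptimal_of_le (n : ℕ) (hn : 1 ≤ n) (a b a' b' : Fin (2 * n + 1) → ℕ)
    (hopt : IsOptimalFactorization n a b)
    (ha : ∀ i, a' i ≤ a i) (hb : ∀ j, b' j ≤ b j) :
    IsOptimalFactorization n a' b' := by
  intro c d h
  have key := hopt (fun i => a i - a' i + c i) (fun j => b j - b' j + d j) (by
    intro i
    have h1 := h i
    have h2 := ha i
    have h3 := hb i
    have h4 := hb (i - 1)
    omega)
  rw [Finset.sum_add_distrib] at key
  have hs : ∑ j, (b j - b' j) + ∑ j, b' j = ∑ j, b j := by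
    rw [← Finset.sum_add_distrib]
    exact Finset.sum_congr rfl (fun j _ => Nat.sub_add_cancel (hb j))
  omega
end
end

section
/- Let I = I(C_{2n+1}) be the edge ideal of the odd cycle C_{2n+1} in R = k[x_1,…,x_{2n+1}]. Then for every t ≥ 1, the t-th symbolic power satisfies I^(t) = I^t + (D(t)), where (D(t)) is the ideal generated by the set D(t). -/
open MvPolynomial

noncomputable section

/-! ### Auxiliary lemmas -/

/-- weight of a Boolean vertex set on `0..N-1` -/
def wtB (N : ℕ) (b : ℕ → ℕ) (c : ℕ → Bool) : ℕ :=
  ∑ i ∈ Finset.range N, if c i then b i else 0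

/-- path vertex cover -/
def PathCov (N : ℕ) (c : ℕ → Bool) : Prop :=
  ∀ i, i + 1 < N → c i = true ∨ c (i + 1) = true

lemma wtB_congr (N : ℕ) (b b' : ℕ → ℕ) (c c' : ℕ → Bool)
    (h : ∀ i < N, (if c i then b i else 0) = (if c' i then b' i else 0)) :
    wtB N b c = wtB N b' c' :=
  Finset.sum_congr rfl (fun i hi => h i (Finset.mem_range.1 hi))

lemma path_mem {R : Type*} [CommRing R] (y : ℕ → R) (I : Ideal R) :
    ∀ (N : ℕ) (b : ℕ → ℕ) (t : ℕ), (∀ i, i + 1 < N + 1 → y i * y (i + 1) ∈ I) →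
      (∀ c, PathCov (N + 1) c → t ≤ wtB (N + 1) b c) →
      ∏ i ∈ Finset.range (N + 1), y i ^ b i ∈ I ^ t := by
  intro N
  induction N with
  | zero =>
    intro b t _ h
    have := h (fun _ => false) (fun i hi => by omega)
    simp [wtB] at this
    subst this
    simp
  | succ N ih =>
    intro b t hI h
    set m := min (b N) (b (N + 1)) with hm
    set b' : ℕ → ℕ := fun i => if i = N then b N - m else b i with hb'
    have key : ∀ c, PathCov (N + 1) c → c N = true → t ≤ wtB (N + 1) b' c + m := by
      intro c hc hcN
      have h1 := h (fun i => if i = N + 1 then false else c i) (by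
        intro i hi
        by_cases hiN : i = N
        · subst hiN; left; simp [hcN]
        · have := hc i (by omega)
          have h2 : i ≠ N + 1 := by omega
          simpa [hiN, h2] using this)
      unfold wtB at h1 ⊢
      rw [Finset.sum_range_succ, Finset.sum_range_succ] at h1
      rw [Finset.sum_range_succ]
      have e : ∑ i ∈ Finset.range N, (if (if i = N + 1 then false else c i) = true then b i else 0)
          = ∑ i ∈ Finset.range N, (if c i = true then b' i else 0) := by
        apply Finset.sum_congr rfl
        intro i hi
        have := Finset.mem_range.1 hi
        have h2 : i ≠ N + 1 := by omega
        have h3 : i ≠ N := by omega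
        simp [h2, h3, hb']
      have hmN : m ≤ b N := min_le_left _ _
      rw [e] at h1
      simp [hcN, hb'] at h1 ⊢
      omega
    have hstep := ih b' (t - m) (fun i hi => hI i (by omega)) (by
      intro c hc
      by_cases hcN : c N = true
      · have := key c hc hcN; omega
      · by_cases hlt : b (N + 1) ≤ b N
        · have hmm : m = b (N + 1) := min_eq_right hlt
          have h1 := h (fun i => if i = N + 1 then true else c i) (by
            intro i hi
            by_cases hiN : i = N
            · subst hiN; right; simp
            · have := hc i (by omega)
              have h2 : i ≠ N + 1 := by omega
              simpa [hiN, h2] using this)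
          unfold wtB at h1 ⊢
          rw [Finset.sum_range_succ] at h1
          have e : ∑ i ∈ Finset.range (N + 1),
              (if (if i = N + 1 then true else c i) = true then b i else 0)
              = ∑ i ∈ Finset.range (N + 1), (if c i = true then b' i else 0) := by
            apply Finset.sum_congr rfl
            intro i hi
            have := Finset.mem_range.1 hi
            have h2 : i ≠ N + 1 := by omega
            by_cases h3 : i = N
            · subst h3; simp [hcN]
            · simp [h2, h3, hb']
          rw [e] at h1
          simp at h1
          omega
        · have hmm : m = b N := min_eq_left (by omega)
          have h1 := key (fun i => if i = N then true else c i) (by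
            intro i hi
            have := hc i hi
            by_cases h3 : i = N
            · simp [h3]
            · by_cases h4 : i + 1 = N
              · simp [h4]
              · simpa [h3, h4] using this) (by simp)
          have e : wtB (N + 1) b' (fun i => if i = N then true else c i) = wtB (N + 1) b' c := by
            apply wtB_congr
            intro i _
            by_cases h3 : i = N
            · simp [h3, hb', hmm]
            · simp [h3]
          omega)
    have hfac : ∏ i ∈ Finset.range (N + 1 + 1), y i ^ b i
        = (∏ i ∈ Finset.range (N + 1), y i ^ b' i) * (y N * y (N + 1)) ^ m
          * y (N + 1) ^ (b (N + 1) - m) := by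
      rw [Finset.prod_range_succ, Finset.prod_range_succ, Finset.prod_range_succ]
      have e : ∏ i ∈ Finset.range N, y i ^ b' i = ∏ i ∈ Finset.range N, y i ^ b i := by
        apply Finset.prod_congr rfl
        intro i hi
        have := Finset.mem_range.1 hi
        have h3 : i ≠ N := by omega
        simp [hb', h3]
      have e1 : y N ^ b N = y N ^ (b N - m) * y N ^ m := by
        rw [← pow_add]; congr 1; omega
      have e2 : y (N + 1) ^ b (N + 1) = y (N + 1) ^ (b (N + 1) - m) * y (N + 1) ^ m := by
        rw [← pow_add]; congr 1; omega
      have e3 : b' N = b N - m := by simp [hb']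
      rw [e, e1, e2, e3]; ring
    rw [hfac]
    apply Ideal.mul_mem_right
    have := Ideal.mul_mem_mul hstep (Ideal.pow_mem_pow (hI N (by omega)) m)
    rw [← pow_add] at this
    exact Ideal.pow_le_pow_right (by omega) this

/-- uncrossing -/
lemma uncross (M t : ℕ) (hM : Even M) (a : ℕ → ℕ)
    (hdeg : 2 * t ≤ ∑ i ∈ Finset.range (M + 1), a i)
    (hcov : ∀ c, PathCov (M + 1) c → (c 0 = true ∨ c M = true) → t ≤ wtB (M + 1) a c)
    (c d : ℕ → Bool) (hc : PathCov (M + 1) c) (hd : PathCov (M + 1) d)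
    (hc0 : c 0 = false) (hcM : c M = false) (hd0 : d 0 = true) (hdM : d M = true) :
    2 * t ≤ wtB (M + 1) a c + wtB (M + 1) a d := by
  by_cases hsw : ∃ i, i + 1 < M + 1 ∧ (c i = true ∨ d (i + 1) = true) ∧
      (d i = true ∨ c (i + 1) = true)
  · obtain ⟨i, hi, h1, h2⟩ := hsw
    have swp : ∀ c d : ℕ → Bool, PathCov (M + 1) c → PathCov (M + 1) d →
        (c i = true ∨ d (i + 1) = true) →
        PathCov (M + 1) (fun j => if j ≤ i then c j else d j) := by
      intro c d hc hd h j hj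
      rcases lt_trichotomy j i with hlt | heq | hgt
      · have e1 : j ≤ i := by omega
        have e2 : j + 1 ≤ i := by omega
        simpa only [e1, e2, if_true] using hc j hj
      · subst heq
        simpa using h
      · have e1 : ¬ j ≤ i := by omega
        have e2 : ¬ j + 1 ≤ i := by omega
        simpa only [e1, e2, if_false] using hd j hj
    have hMi : ¬ M ≤ i := by omega
    have k1 := hcov _ (swp c d hc hd h1) (by right; simp [hMi, hdM])
    have k2 := hcov _ (swp d c hd hc h2) (by left; simp [hd0])
    have e : wtB (M + 1) a (fun j => if j ≤ i then c j else d j)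
        + wtB (M + 1) a (fun j => if j ≤ i then d j else c j)
        = wtB (M + 1) a c + wtB (M + 1) a d := by
      unfold wtB
      rw [← Finset.sum_add_distrib, ← Finset.sum_add_distrib]
      apply Finset.sum_congr rfl
      intro j _
      by_cases hj : j ≤ i
      · simp [hj]
      · simp [hj, add_comm]
    omega
  · push Not at hsw
    have alt : ∀ i, i < M + 1 → (d i = !c i) := by
      intro i
      induction i with
      | zero => intro _; simp [hc0, hd0]
      | succ i ih =>
        intro hi
        have h1 := ih (by omega)
        have h2 := hsw i hi
        have h3 := hc i hi
        have h4 := hd i hi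
        revert h1 h2 h3 h4
        cases c i <;> cases d i <;> cases c (i + 1) <;> cases d (i + 1) <;> simp
    have e : wtB (M + 1) a c + wtB (M + 1) a d = ∑ i ∈ Finset.range (M + 1), a i := by
      unfold wtB
      rw [← Finset.sum_add_distrib]
      apply Finset.sum_congr rfl
      intro j hj
      rw [alt j (Finset.mem_range.1 hj)]
      cases c j <;> simp
    omega

lemma ends_sum {A : Type*} [AddCommMonoid A] (k : ℕ) (f : ℕ → A) :
    ∑ i ∈ Finset.range (k + 1 + 1), f i = f 0 + (∑ i ∈ Finset.range k, f (i + 1)) + f (k + 1) := by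
  rw [Finset.sum_range_succ, Finset.sum_range_succ', add_comm (f 0)]

lemma ends_prod {A : Type*} [CommMonoid A] (k : ℕ) (f : ℕ → A) :
    ∏ i ∈ Finset.range (k + 1 + 1), f i = f 0 * (∏ i ∈ Finset.range k, f (i + 1)) * f (k + 1) := by
  rw [Finset.prod_range_succ, Finset.prod_range_succ', mul_comm (f 0)]

lemma cycle_mem {R : Type*} [CommRing R] (y : ℕ → R) (I : Ideal R) (k t : ℕ)
    (hM : Even (k + 1)) (a : ℕ → ℕ)
    (hI : ∀ i, i + 1 < k + 1 + 1 → y i * y (i + 1) ∈ I) (hI0 : y 0 * y (k + 1) ∈ I)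
    (hdeg : 2 * t ≤ ∑ i ∈ Finset.range (k + 1 + 1), a i)
    (hcov : ∀ c, PathCov (k + 1 + 1) c → (c 0 = true ∨ c (k + 1) = true) →
      t ≤ wtB (k + 1 + 1) a c) :
    ∏ i ∈ Finset.range (k + 1 + 1), y i ^ a i ∈ I ^ t := by
  classical
  have hex : ∃ s, ∀ c, PathCov (k + 1 + 1) c → c 0 = false → c (k + 1) = false →
      t ≤ wtB (k + 1 + 1) a c + s := ⟨t, fun _ _ _ _ => by omega⟩
  obtain ⟨s, hs, hmin⟩ : ∃ s, (∀ c, PathCov (k + 1 + 1) c → c 0 = false → c (k + 1) = false →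
      t ≤ wtB (k + 1 + 1) a c + s) ∧ (s = 0 ∨ ∃ c, PathCov (k + 1 + 1) c ∧ c 0 = false ∧
        c (k + 1) = false ∧ wtB (k + 1 + 1) a c + s ≤ t) := by
    refine ⟨Nat.find hex, Nat.find_spec hex, ?_⟩
    by_cases h0 : Nat.find hex = 0
    · left; exact h0
    · right
      have := Nat.find_min hex (m := Nat.find hex - 1) (by omega)
      push Not at this
      obtain ⟨c, h1, h2, h3, h4⟩ := this
      exact ⟨c, h1, h2, h3, by omega⟩
  have hs0 : s ≤ a 0 := by
    rcases hmin with h | ⟨c, h1, h2, h3, h4⟩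
    · omega
    · have := hcov (fun i => if i = 0 then true else c i) (by
        intro i hi
        have := h1 i hi
        by_cases hi0 : i = 0
        · simp [hi0]
        · simpa [hi0] using this) (by left; simp)
      unfold wtB at this h4
      rw [ends_sum] at this h4
      simp [h2, h3] at this h4
      omega
  have hsM : s ≤ a (k + 1) := by
    rcases hmin with h | ⟨c, h1, h2, h3, h4⟩
    · omega
    · have := hcov (fun i => if i = k + 1 then true else c i) (by
        intro i hi
        have := h1 i hi
        by_cases hi0 : i = k
        · right; simp [hi0]
        · have h5 : i ≠ k + 1 := by omega
          simpa [hi0, h5] using this) (by right; simp)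
      unfold wtB at this h4
      rw [ends_sum] at this h4
      have e : ∑ i ∈ Finset.range k, (if (if i + 1 = k + 1 then true else c (i + 1)) = true
          then a (i + 1) else 0) = ∑ i ∈ Finset.range k, (if c (i + 1) = true
          then a (i + 1) else 0) := by
        apply Finset.sum_congr rfl
        intro i hi
        have := Finset.mem_range.1 hi
        have h5 : i ≠ k := by omega
        simp [h5]
      rw [e] at this
      simp [h2, h3] at this h4
      omega
  have hsD : ∀ d, PathCov (k + 1 + 1) d → d 0 = true → d (k + 1) = true →
      t + s ≤ wtB (k + 1 + 1) a d := by
    intro d hd hd0 hdM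
    rcases hmin with h | ⟨c, h1, h2, h3, h4⟩
    · have := hcov d hd (Or.inl hd0); omega
    · have := uncross (k + 1) t hM a hdeg hcov c d h1 hd h2 h3 hd0 hdM
      omega
  set b : ℕ → ℕ := fun i => if i = 0 ∨ i = k + 1 then a i - s else a i with hb
  have hpath := path_mem y I (k + 1) b (t - s) hI (by
    intro c hc
    have e : ∑ i ∈ Finset.range k, (if c (i + 1) = true then b (i + 1) else 0)
        = ∑ i ∈ Finset.range k, (if c (i + 1) = true then a (i + 1) else 0) := by
      apply Finset.sum_congr rfl
      intro i hi
      have := Finset.mem_range.1 hi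
      have h5 : i ≠ k := by omega
      simp [hb, h5]
    have g1 := hcov c hc
    have g2 := hs c hc
    have g3 := hsD c hc
    have b0 : b 0 = a 0 - s := by simp [hb]
    have bM : b (k + 1) = a (k + 1) - s := by simp [hb]
    unfold wtB at *
    rw [ends_sum] at *
    rw [e, b0, bM]
    cases h0 : c 0 <;> cases hM : c (k + 1) <;> simp [h0, hM] at g1 g2 g3 ⊢ <;> omega)
  have hfac : ∏ i ∈ Finset.range (k + 1 + 1), y i ^ a i
      = (∏ i ∈ Finset.range (k + 1 + 1), y i ^ b i) * (y 0 * y (k + 1)) ^ s := by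
    rw [ends_prod, ends_prod]
    have e : ∏ i ∈ Finset.range k, y (i + 1) ^ b (i + 1)
        = ∏ i ∈ Finset.range k, y (i + 1) ^ a (i + 1) := by
      apply Finset.prod_congr rfl
      intro i hi
      have := Finset.mem_range.1 hi
      have h5 : i ≠ k := by omega
      simp [hb, h5]
    have b0 : b 0 = a 0 - s := by simp [hb]
    have bM : b (k + 1) = a (k + 1) - s := by simp [hb]
    have e1 : y 0 ^ a 0 = y 0 ^ (a 0 - s) * y 0 ^ s := by
      rw [← pow_add]; congr 1; omega
    have e2 : y (k + 1) ^ a (k + 1) = y (k + 1) ^ (a (k + 1) - s) * y (k + 1) ^ s := by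
      rw [← pow_add]; congr 1; omega
    rw [e, b0, bM, e1, e2]; ring
  rw [hfac]
  have := Ideal.mul_mem_mul hpath (Ideal.pow_mem_pow hI0 s)
  rw [← pow_add] at this
  exact Ideal.pow_le_pow_right (by omega) this

lemma exists_minCover {N : ℕ} (G : SimpleGraph (Fin N)) (S : Finset (Fin N)) :
    IsVertexCover G S → ∃ T ⊆ S, IsMinVertexCover G T := by
  induction S using Finset.strongInduction with
  | H S ih =>
    intro hS
    by_cases h : ∃ T ⊂ S, IsVertexCover G T
    · obtain ⟨T, hT, hc⟩ := h
      obtain ⟨U, hU, hm⟩ := ih T hT hc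
      exact ⟨U, hU.trans hT.1, hm⟩
    · push Not at h
      exact ⟨S, subset_rfl, hS, h⟩

lemma varIdeal_pow_support (K : Type*) [Field K] (N : ℕ) (S : Finset (Fin N)) (t : ℕ) :
    ∀ p ∈ varIdeal K N S ^ t, ∀ a ∈ p.support, t ≤ ∑ i ∈ S, a i := by
  classical
  have hmul : ∀ (s t : ℕ) (p q : MvPolynomial (Fin N) K),
      (∀ a ∈ p.support, s ≤ ∑ i ∈ S, a i) → (∀ a ∈ q.support, t ≤ ∑ i ∈ S, a i) →
      ∀ a ∈ (p * q).support, s + t ≤ ∑ i ∈ S, a i := by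
    intro s t p q hp hq a ha
    obtain ⟨u, hu, v, hv, rfl⟩ := Finset.mem_add.1 (MvPolynomial.support_mul p q ha)
    have := hp u hu
    have := hq v hv
    simp only [Finsupp.add_apply, Finset.sum_add_distrib]
    omega
  have hadd : ∀ (s : ℕ) (p q : MvPolynomial (Fin N) K),
      (∀ a ∈ p.support, s ≤ ∑ i ∈ S, a i) → (∀ a ∈ q.support, s ≤ ∑ i ∈ S, a i) →
      ∀ a ∈ (p + q).support, s ≤ ∑ i ∈ S, a i := by
    intro s p q hp hq a ha
    rcases Finset.mem_union.1 (MvPolynomial.support_add ha) with h | h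
    · exact hp a h
    · exact hq a h
  have h1 : ∀ p ∈ varIdeal K N S, ∀ a ∈ p.support, 1 ≤ ∑ i ∈ S, a i := by
    intro p hp
    refine Submodule.span_induction ?_ ?_ ?_ ?_ hp
    · rintro _ ⟨i, hi, rfl⟩ a ha
      simp only [MvPolynomial.support_X, Finset.mem_singleton] at ha
      subst ha
      calc 1 = (Finsupp.single i 1 : Fin N →₀ ℕ) i := by simp
        _ ≤ _ := Finset.single_le_sum (f := fun j => (Finsupp.single i 1 : Fin N →₀ ℕ) j)
          (fun _ _ => Nat.zero_le _) hi
    · simp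
    · intro p q _ _ hp hq; exact hadd 1 p q hp hq
    · intro r q _ hq
      have := hmul 0 1 r q (fun _ _ => Nat.zero_le _) hq
      simpa using this
  induction t with
  | zero => intro p _ a _; exact Nat.zero_le _
  | succ t ih =>
    intro p hp
    rw [pow_succ] at hp
    refine Submodule.mul_induction_on hp ?_ ?_
    · intro m hm n hn
      exact hmul t 1 m n (ih m hm) (h1 n hn)
    · intro p q hp hq; exact hadd _ p q hp hq

lemma monomial_mem_varIdeal_pow (K : Type*) [Field K] (N : ℕ) (S : Finset (Fin N)) (t : ℕ)
    (a : Fin N →₀ ℕ) (h : t ≤ ∑ i ∈ S, a i) :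
    (monomial a (1 : K)) ∈ varIdeal K N S ^ t := by
  classical
  apply Ideal.pow_le_pow_right h
  have e : (monomial a (1 : K)) = ∏ i, (X i : MvPolynomial (Fin N) K) ^ a i := by
    rw [MvPolynomial.monomial_eq, Finsupp.prod_fintype] <;> simp
  rw [e, ← Finset.prod_sdiff (Finset.subset_univ S), ← Finset.prod_pow_eq_pow_sum]
  apply Ideal.mul_mem_left
  apply Ideal.prod_mem_prod
  intro i hi
  have hX : (X i : MvPolynomial (Fin N) K) ∈ varIdeal K N S := Ideal.subset_span ⟨i, hi, rfl⟩
  exact Ideal.pow_mem_pow hX _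

lemma edgeIdeal_le (K : Type*) [Field K] {N : ℕ} (G : SimpleGraph (Fin N)) (S : Finset (Fin N))
    (hS : IsVertexCover G S) : edgeIdeal K G ≤ varIdeal K N S := by
  apply Ideal.span_le.2
  rintro _ ⟨i, j, hij, rfl⟩
  rcases hS hij with h | h
  · exact Ideal.mul_mem_right _ _ (Ideal.subset_span ⟨i, h, rfl⟩)
  · exact Ideal.mul_mem_left _ _ (Ideal.subset_span ⟨j, h, rfl⟩)

lemma monomial_mem_edge_pow (K : Type*) [Field K] (n t : ℕ) (hn : 1 ≤ n)
    (a : Fin (2 * n + 1) →₀ ℕ) (hdeg : 2 * t ≤ ∑ i, a i)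
    (h : ∀ S : Finset (Fin (2 * n + 1)), IsMinVertexCover (cycleGraph (2 * n + 1)) S →
      t ≤ ∑ i ∈ S, a i) :
    (monomial a (1 : K)) ∈ edgeIdeal K (cycleGraph (2 * n + 1)) ^ t := by
  classical
  have hk : ∃ k, 2 * n = k + 1 := ⟨2 * n - 1, by omega⟩
  have hev : Even (2 * n) := even_two_mul n
  generalize 2 * n = M at *
  obtain ⟨k, rfl⟩ := hk
  have hk1 : 1 ≤ k := by
    rcases Nat.eq_zero_or_pos k with h0 | h0
    · subst h0; simp at hev
    · exact h0
  set y : ℕ → MvPolynomial (Fin (k + 1 + 1)) K := fun i => X (Fin.ofNat (k + 1 + 1) i) with hy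
  set b : ℕ → ℕ := fun i => a (Fin.ofNat (k + 1 + 1) i) with hb
  have hcast : ∀ i : Fin (k + 1 + 1), Fin.ofNat (k + 1 + 1) (i : ℕ) = i := by
    intro i; ext; simp [Nat.mod_eq_of_lt i.2]
  have e : (monomial a (1 : K)) = ∏ i ∈ Finset.range (k + 1 + 1), y i ^ b i := by
    rw [MvPolynomial.monomial_eq, Finsupp.prod_fintype _ _ (by simp),
      Finset.prod_range]
    simp only [hy, hb, hcast, C_1, one_mul]
  rw [e]
  apply cycle_mem y _ k t hev b
  · intro i hi
    refine Ideal.subset_span ⟨_, _, ?_, rfl⟩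
    simp only [cycleGraph, SimpleGraph.fromRel_adj]
    refine ⟨?_, Or.inl ?_⟩
    · intro hh
      have := congrArg Fin.val hh
      simp only [Fin.val_ofNat] at this
      rw [Nat.mod_eq_of_lt (by omega), Nat.mod_eq_of_lt hi] at this
      omega
    · simp
  · refine Ideal.subset_span ⟨_, _, ?_, rfl⟩
    simp only [cycleGraph, SimpleGraph.fromRel_adj]
    refine ⟨?_, Or.inr ?_⟩
    · intro hh
      have := congrArg Fin.val hh
      simp only [Fin.val_ofNat] at this
      rw [Nat.mod_eq_of_lt (by omega), Nat.mod_eq_of_lt (by omega)] at this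
      omega
    · simp
  · rw [Finset.sum_range]
    simpa only [hb, hcast] using hdeg
  · intro c hc hc0
    have hedge : ∀ i j : Fin (k + 1 + 1), (j : ℕ) = ((i : ℕ) + 1) % (k + 1 + 1) →
        c i = true ∨ c j = true := by
      intro i j hij
      have hi := i.2
      by_cases hl : (i : ℕ) = k + 1
      · rw [hl, Nat.mod_self] at hij
        rw [hl, hij]
        exact hc0.symm
      · rw [Nat.mod_eq_of_lt (by omega)] at hij
        rw [hij]
        exact hc i (by omega)
    obtain ⟨T, hT, hmin⟩ := exists_minCover (cycleGraph (k + 1 + 1))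
      (Finset.univ.filter (fun i : Fin (k + 1 + 1) => c i = true)) (by
        intro i j hij
        simp only [cycleGraph, SimpleGraph.fromRel_adj] at hij
        simp only [Finset.mem_filter, Finset.mem_univ, true_and]
        rcases hij.2 with h | h
        · exact hedge i j h
        · exact (hedge j i h).symm)
    refine (h T hmin).trans ((Finset.sum_le_sum_of_subset hT).trans ?_)
    unfold wtB
    rw [Finset.sum_range, Finset.sum_filter]
    simp only [hb, hcast, le_refl]

/-- For the edge ideal of an odd cycle, `I^(t) = I^t + (D(t))`. -/
theorem symbolicPower_eq_pow_add_span_Dset (K : Type*) [Field K] (n t : ℕ)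
    (hn : 1 ≤ n) (ht : 1 ≤ t) :
    symbolicPower K (cycleGraph (2 * n + 1)) t
      = edgeIdeal K (cycleGraph (2 * n + 1)) ^ t
        + Ideal.span (Dset K (cycleGraph (2 * n + 1)) t) := by
  apply le_antisymm
  · intro p hp
    have hp' : ∀ S, IsMinVertexCover (cycleGraph (2 * n + 1)) S →
        p ∈ varIdeal K (2 * n + 1) S ^ t := by
      simpa [symbolicPower, Ideal.mem_iInf] using hp
    rw [p.as_sum]
    apply Ideal.sum_mem
    intro a ha
    have hw : ∀ S, IsMinVertexCover (cycleGraph (2 * n + 1)) S → t ≤ ∑ i ∈ S, a i :=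
      fun S hS => varIdeal_pow_support K _ S t p (hp' S hS) a ha
    have e : monomial a (coeff a p) = C (coeff a p) * monomial a (1 : K) := by
      rw [C_mul_monomial, mul_one]
    rw [e]
    apply Ideal.mul_mem_left
    by_cases hd : 2 * t ≤ ∑ i, a i
    · exact Ideal.mem_sup_left (monomial_mem_edge_pow K n t hn a hd hw)
    · exact Ideal.mem_sup_right (Ideal.subset_span ⟨a, rfl, by omega, hw⟩)
  · refine sup_le ?_ (Ideal.span_le.2 ?_)
    · refine le_iInf₂ fun S hS => Ideal.pow_right_mono (edgeIdeal_le K _ S hS.1) t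
    · rintro _ ⟨a, rfl, _, hw⟩
      simp only [symbolicPower, SetLike.mem_coe, Ideal.mem_iInf]
      exact fun S hS => monomial_mem_varIdeal_pow K _ S t a (hw S hS)
end
end

section
/- Let C_{2n+1} be the odd cycle on vertices x_1,…,x_{2n+1} and t ≥ 1. If a monomial x^a belongs to the set D(t) and deg(x^a) = 2t − k, then x^a is divisible by (x_1 x_2 ⋯ x_{2n+1})^k. -/
open MvPolynomial

noncomputable section

/-- Every vertex cover contains a minimal vertex cover. -/
theorem exists_minCover_subset {N : ℕ} (G : SimpleGraph (Fin N)) (S : Finset (Fin N))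
    (hS : IsVertexCover G S) : ∃ T ⊆ S, IsMinVertexCover G T := by
  induction S using Finset.strongInduction with
  | H S ih =>
    by_cases h : ∀ T ⊂ S, ¬ IsVertexCover G T
    · exact ⟨S, Finset.Subset.refl S, hS, h⟩
    · push Not at h
      obtain ⟨T, hT, hc⟩ := h
      obtain ⟨U, hU, hm⟩ := ih T hT hc
      exact ⟨U, hU.trans hT.1, hm⟩

/-- `j` lies at an odd clockwise distance from `i` on the odd cycle. -/
def oddOffset {N : ℕ} (i j : Fin N) : Prop :=
  ((i : ℕ) ≤ j ∧ ((i : ℕ) + j) % 2 = 1) ∨ ((j : ℕ) < i ∧ ((i : ℕ) + j) % 2 = 0)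

theorem oddOffset_succ {n : ℕ} (i u v : Fin (2 * n + 1))
    (h : (v : ℕ) = ((u : ℕ) + 1) % (2 * n + 1)) :
    (u = i ∨ v = i) ∨ (oddOffset i u ↔ ¬ oddOffset i v) := by
  simp only [oddOffset, Fin.ext_iff]
  have hu := u.2
  have hv := v.2
  have hi := i.2
  have h' : (v : ℕ) = u + 1 ∨ ((v : ℕ) = 0 ∧ (u : ℕ) = 2 * n) := by
    by_cases hh : (u : ℕ) + 1 < 2 * n + 1
    · rw [Nat.mod_eq_of_lt hh] at h
      exact Or.inl h
    · have hh' : (u : ℕ) + 1 = 2 * n + 1 := by omega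
      rw [hh', Nat.mod_self] at h
      exact Or.inr ⟨h, by omega⟩
  clear h
  omega

theorem oddOffset_adj {n : ℕ} (i u v : Fin (2 * n + 1))
    (h : (cycleGraph (2 * n + 1)).Adj u v) :
    (u = i ∨ v = i) ∨ (oddOffset i u ↔ ¬ oddOffset i v) := by
  obtain ⟨-, h | h⟩ := h
  · exact oddOffset_succ i u v h
  · have := oddOffset_succ i v u h
    grind

/-- If a monomial `x^a` belongs to `D(t)` and `deg(x^a) = 2t - c`, then `x^a`
is divisible by `(x_1 x_2 ⋯ x_{2n+1})^c`. -/
theorem prod_pow_dvd_of_mem_Dset (K : Type*) [Field K] (n t c : ℕ)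
    (hn : 1 ≤ n) (ht : 1 ≤ t) (a : Fin (2 * n + 1) →₀ ℕ)
    (hD : (monomial a (1 : K)) ∈ Dset K (cycleGraph (2 * n + 1)) t)
    (hdeg : (∑ i, a i) + c = 2 * t) :
    (∏ i, (X i : MvPolynomial (Fin (2 * n + 1)) K)) ^ c ∣ monomial a (1 : K) := by
  classical
  obtain ⟨b, hb, -, hw⟩ := hD
  have hab : a = b := monomial_left_injective (one_ne_zero : (1 : K) ≠ 0) hb
  subst hab
  have hcov : ∀ S, IsVertexCover (cycleGraph (2 * n + 1)) S → t ≤ ∑ i ∈ S, a i := by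
    intro S hS
    obtain ⟨T, hT, hm⟩ := exists_minCover_subset _ S hS
    exact (hw T hm).trans (Finset.sum_le_sum_of_subset hT)
  have key : ∀ i, c ≤ a i := by
    intro i
    have h1 := hcov (Finset.univ.filter fun j => j = i ∨ oddOffset i j) (by
      intro u v h
      have := oddOffset_adj i u v h
      simp only [Finset.mem_filter, Finset.mem_univ, true_and]
      grind)
    have h2 := hcov (Finset.univ.filter fun j => j = i ∨ ¬ oddOffset i j) (by
      intro u v h
      have := oddOffset_adj i u v h
      simp only [Finset.mem_filter, Finset.mem_univ, true_and]
      grind)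
    have h3 := Finset.sum_union_inter
      (s₁ := Finset.univ.filter fun j => j = i ∨ oddOffset i j)
      (s₂ := Finset.univ.filter fun j => j = i ∨ ¬ oddOffset i j) (f := fun j => a j)
    have e1 : (Finset.univ.filter fun j => j = i ∨ oddOffset i j) ∪
        (Finset.univ.filter fun j => j = i ∨ ¬ oddOffset i j) = Finset.univ := by
      ext j
      simp only [Finset.mem_union, Finset.mem_filter, Finset.mem_univ, true_and, iff_true]
      grind
    have e2 : (Finset.univ.filter fun j => j = i ∨ oddOffset i j) ∩
        (Finset.univ.filter fun j => j = i ∨ ¬ oddOffset i j) = {i} := by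
      ext j
      simp only [Finset.mem_inter, Finset.mem_filter, Finset.mem_univ, true_and,
        Finset.mem_singleton]
      grind
    rw [e1, e2, Finset.sum_singleton] at h3
    omega
  have hmon : monomial a (1 : K) = ∏ i, (X i : MvPolynomial (Fin (2 * n + 1)) K) ^ a i := by
    rw [monomial_eq, C_1, one_mul, Finsupp.prod_fintype _ _ (fun _ => pow_zero _)]
  rw [hmon, ← Finset.prod_pow]
  exact Finset.prod_dvd_prod_of_dvd _ _ fun i _ => pow_dvd_pow _ (key i)
end
end

section
/- Let I = I(C_{2n+1}) be the edge ideal of the odd cycle C_{2n+1}. If I^(m) ⊄ I^r for positive integers m, r, then I^(m+2n+2) ⊄ I^{r+2n+1}. -/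
open MvPolynomial

noncomputable section

section Generic

open Finset

variable {R : Type*} [CommRing R]

/-- Weighted path: a monomial is in the power given by some cover weight. -/
theorem path_lemma (x : ℕ → R) (I : Ideal R) (k : ℕ) :
    (∀ i < k, x i * x (i + 1) ∈ I) → ∀ a : ℕ → ℕ, ∃ s : ℕ → Bool,
      (∀ i < k, s i = true ∨ s (i + 1) = true) ∧
      ∏ i ∈ range (k + 1), x i ^ a i ∈
        I ^ (∑ i ∈ range (k + 1), if s i = true then a i else 0) := by
  induction k with
  | zero =>
    intro _ a
    exact ⟨fun _ => false, by simp, by simp⟩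
  | succ k ih =>
    intro hx a
    obtain ⟨s, hs, hm⟩ := ih (fun i hi => hx i (by omega))
      (Function.update a k (a k - min (a k) (a (k + 1))))
    set c := min (a k) (a (k + 1)) with hc
    rw [prod_range_succ, sum_range_succ] at hm
    have e1 : ∏ i ∈ range k, x i ^ (Function.update a k (a k - c) i)
        = ∏ i ∈ range k, x i ^ a i := by
      apply prod_congr rfl
      intro i hi
      rw [Function.update_of_ne (by have := mem_range.1 hi; omega)]
    have e2 : ∑ i ∈ range k, (if s i = true then (Function.update a k (a k - c) i) else 0)
        = ∑ i ∈ range k, (if s i = true then a i else 0) := by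
      apply sum_congr rfl
      intro i hi
      rw [Function.update_of_ne (by have := mem_range.1 hi; omega)]
    rw [e1, e2, Function.update_self] at hm
    have hk := Ideal.pow_mem_pow (hx k (by omega)) c
    have hprod : ∏ i ∈ range (k + 1 + 1), x i ^ a i
        = ((∏ i ∈ range k, x i ^ a i) * x k ^ (a k - c)) * (x k * x (k + 1)) ^ c
          * x (k + 1) ^ (a (k + 1) - c) := by
      rw [prod_range_succ, prod_range_succ]
      have h1 : x k ^ a k = x k ^ (a k - c) * x k ^ c := by
        rw [← pow_add]; congr 1; omega
      have h2 : x (k + 1) ^ a (k + 1) = x (k + 1) ^ (a (k + 1) - c) * x (k + 1) ^ c := by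
        rw [← pow_add]; congr 1; omega
      rw [h1, h2, mul_pow]; ring
    have hmem : ∏ i ∈ range (k + 1 + 1), x i ^ a i ∈
        I ^ ((∑ i ∈ range k, (if s i = true then a i else 0)) +
          (if s k = true then a k - c else 0) + c) := by
      rw [hprod, pow_add I _ c]
      exact Ideal.mul_mem_right _ _ (Ideal.mul_mem_mul hm hk)
    by_cases hcase : a k ≤ a (k + 1) ∨ s k = true
    · refine ⟨fun i => if i = k then true else if i = k + 1 then false else s i, ?_, ?_⟩
      · intro i hi
        have := hs i
        grind
      · convert hmem using 2
        rw [sum_range_succ, sum_range_succ, add_assoc, add_assoc]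
        congr 1
        · apply sum_congr rfl
          intro i hi
          have := mem_range.1 hi
          grind
        · grind
    · push Not at hcase
      refine ⟨fun i => if i = k + 1 then true else s i, ?_, ?_⟩
      · intro i hi
        have := hs i
        grind
      · convert hmem using 2
        rw [sum_range_succ, sum_range_succ, add_assoc, add_assoc]
        congr 1
        · apply sum_congr rfl
          intro i hi
          have := mem_range.1 hi
          grind
        · grind

/-- Swapping lemma. -/
theorem swap_lemma (k r : ℕ) (a : ℕ → ℕ)
    (hcov : ∀ s : ℕ → Bool, (∀ i < k, s i = true ∨ s (i + 1) = true) →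
      (s k = true ∨ s 0 = true) → r ≤ ∑ i ∈ range (k + 1), if s i = true then a i else 0)
    (hdeg : 2 * r ≤ ∑ i ∈ range (k + 1), a i) (s t : ℕ → Bool)
    (hs : ∀ i < k, s i = true ∨ s (i + 1) = true)
    (ht : ∀ i < k, t i = true ∨ t (i + 1) = true)
    (hs0 : s 0 = true) (hsk : s k = true) :
    2 * r ≤ (∑ i ∈ range (k + 1), if s i = true then a i else 0)
      + ∑ i ∈ range (k + 1), if t i = true then a i else 0 := by
  by_cases hd : ∃ j ≤ k, s j = true ∧ t j = true
  · obtain ⟨j, hj, hsj, htj⟩ := hd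
    have h1 := hcov (fun i => if i ≤ j then s i else t i) (by
      intro i hi; have := hs i hi; have := ht i hi; grind) (by right; simp [hs0])
    have h2 := hcov (fun i => if i ≤ j then t i else s i) (by
      intro i hi; have := hs i hi; have := ht i hi; grind) (by
        left; grind)
    have h12 := add_le_add h1 h2
    rw [← two_mul] at h12
    refine h12.trans (le_of_eq ?_)
    rw [← sum_add_distrib, ← sum_add_distrib]
    apply sum_congr rfl
    intro i _
    grind
  · push Not at hd
    refine hdeg.trans ?_
    rw [← sum_add_distrib]
    apply sum_le_sum
    intro i hi
    have hi' := mem_range.1 hi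
    have : s i = true ∨ t i = true := by
      rcases Nat.eq_zero_or_pos i with h0 | h0
      · subst h0; exact Or.inl hs0
      · have h1 := hs (i - 1) (by omega)
        have h2 := ht (i - 1) (by omega)
        have h3 := hd (i - 1) (by omega)
        have e : i - 1 + 1 = i := by omega
        rw [e] at h1 h2
        grind
    grind

/-- Weighted cycle. -/
theorem cycle_lemma (x : ℕ → R) (I : Ideal R) (k r : ℕ) (hk : 2 ≤ k)
    (hx : ∀ i < k, x i * x (i + 1) ∈ I) (hx0 : x 0 * x k ∈ I) (a : ℕ → ℕ)
    (hcov : ∀ s : ℕ → Bool, (∀ i < k, s i = true ∨ s (i + 1) = true) →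
      (s k = true ∨ s 0 = true) → r ≤ ∑ i ∈ range (k + 1), if s i = true then a i else 0)
    (hdeg : 2 * r ≤ ∑ i ∈ range (k + 1), a i) :
    ∏ i ∈ range (k + 1), x i ^ a i ∈ I ^ r := by
  obtain ⟨k, rfl⟩ : ∃ l, k = l + 1 := ⟨k - 1, by omega⟩
  have split : ∀ f : ℕ → ℕ, ∑ i ∈ range (k + 1 + 1), f i
      = (∑ i ∈ range k, f (i + 1)) + f 0 + f (k + 1) := by
    intro f; rw [sum_range_succ, sum_range_succ']
  have hex : ∃ w, ∃ t : ℕ → Bool, (∀ i < k + 1, t i = true ∨ t (i + 1) = true) ∧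
      t 0 = false ∧ t (k + 1) = false ∧
      (∑ i ∈ range (k + 1 + 1), if t i = true then a i else 0) = w := by
    refine ⟨_, fun i => if i = 0 ∨ i = k + 1 then false else true, ?_, ?_, ?_, rfl⟩
    · intro i hi; grind
    · simp
    · simp
  classical
  obtain ⟨t, ht, ht0, htk, hw⟩ := Nat.find_spec hex
  have hmin := fun w h => Nat.find_min' hex (m := w) h
  set C := Nat.find hex
  set c := r - C with hc
  have hca0 : c ≤ a 0 := by
    have := hcov (fun i => if i = 0 then true else t i) (by
      intro i hi; have := ht i hi; grind) (by simp)
    rw [split] at this hw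
    simp [ht0, htk] at this hw
    omega
  have hcak : c ≤ a (k + 1) := by
    have := hcov (fun i => if i = k + 1 then true else t i) (by
      intro i hi; have := ht i hi; grind) (by simp)
    rw [split] at this hw
    have e : ∑ i ∈ range k, (if (if i + 1 = k + 1 then true else t (i + 1)) = true
        then a (i + 1) else 0) = ∑ i ∈ range k, (if t (i + 1) = true then a (i + 1) else 0) := by
      apply sum_congr rfl
      intro i hi
      have := mem_range.1 hi
      grind
    rw [e] at this
    simp [ht0, htk] at this hw
    omega
  let b : ℕ → ℕ := fun i => if i = 0 then a 0 - c else if i = k + 1 then a (k + 1) - c else a i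
  have hb0 : b 0 = a 0 - c := by simp [b]
  have hbk : b (k + 1) = a (k + 1) - c := by simp [b]
  have hbi : ∀ i < k, b (i + 1) = a (i + 1) := by intro i hi; grind
  obtain ⟨s, hs, hm⟩ := path_lemma x I (k + 1) hx b
  have hprod : ∏ i ∈ range (k + 1 + 1), x i ^ a i
      = (∏ i ∈ range (k + 1 + 1), x i ^ b i) * (x 0 * x (k + 1)) ^ c := by
    rw [prod_range_succ, prod_range_succ', prod_range_succ, prod_range_succ', hb0, hbk]
    have e : ∏ i ∈ range k, x (i + 1) ^ b (i + 1) = ∏ i ∈ range k, x (i + 1) ^ a (i + 1) :=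
      prod_congr rfl fun i hi => by rw [hbi i (mem_range.1 hi)]
    rw [e, mul_pow]
    have h1 : x 0 ^ a 0 = x 0 ^ (a 0 - c) * x 0 ^ c := by
      rw [← pow_add]; congr 1; omega
    have h2 : x (k + 1) ^ a (k + 1) = x (k + 1) ^ (a (k + 1) - c) * x (k + 1) ^ c := by
      rw [← pow_add]; congr 1; omega
    rw [h1, h2]; ring
  have hmem := Ideal.mul_mem_mul hm (Ideal.pow_mem_pow hx0 c)
  rw [← hprod, ← pow_add] at hmem
  refine Ideal.pow_le_pow_right ?_ hmem
  have hsum : ∑ i ∈ range k, (if s (i + 1) = true then b (i + 1) else 0)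
      = ∑ i ∈ range k, (if s (i + 1) = true then a (i + 1) else 0) :=
    sum_congr rfl fun i hi => by rw [hbi i (mem_range.1 hi)]
  have h1 := hcov s hs
  have h2 := swap_lemma (k + 1) r a hcov hdeg s t hs ht
  rw [hw] at h2
  have h3 : s 0 = false → s (k + 1) = false → _ := fun h h' => hmin _ ⟨s, hs, h, h', rfl⟩
  rw [split] at h1 h2 h3 ⊢
  rw [hsum, hb0, hbk]
  cases hs0 : s 0 <;> cases hsk : s (k + 1) <;> simp [hs0, hsk] at h1 h2 h3 ⊢ <;> omega

end Generic

section Weights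

open MvPolynomial Finset

variable {K : Type*} [Field K] {N : ℕ}

/-- Polynomials all of whose monomials have weight at least `d`. -/
def wtIdeal (K : Type*) [Field K] {N : ℕ} (w : Fin N → ℕ) (d : ℕ) :
    Ideal (MvPolynomial (Fin N) K) where
  carrier := {p | ∀ a ∈ p.support, d ≤ ∑ i, w i * a i}
  zero_mem' := by simp
  add_mem' := by
    classical
    intro p q hp hq a ha
    rcases Finset.mem_union.1 (MvPolynomial.support_add ha) with h | h
    · exact hp a h
    · exact hq a h
  smul_mem' := by
    classical
    intro c p hp a ha
    rw [smul_eq_mul] at ha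
    obtain ⟨u, hu, v, hv, rfl⟩ := Finset.mem_add.1 (MvPolynomial.support_mul c p ha)
    refine (hp v hv).trans (Finset.sum_le_sum fun i _ => ?_)
    simp [mul_add]

theorem mem_wtIdeal (w : Fin N → ℕ) (d : ℕ) (p : MvPolynomial (Fin N) K) :
    p ∈ wtIdeal K w d ↔ ∀ a ∈ p.support, d ≤ ∑ i, w i * a i := Iff.rfl

theorem wtIdeal_pow (w : Fin N → ℕ) (d t : ℕ) :
    wtIdeal K w d ^ t ≤ wtIdeal K w (d * t) := by
  classical
  induction t with
  | zero => intro p _; rw [mem_wtIdeal]; simp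
  | succ t ih =>
    rw [pow_succ]
    refine (Ideal.mul_mono_left ih).trans ?_
    rw [Ideal.mul_le]
    intro p hp q hq a ha
    obtain ⟨u, hu, v, hv, rfl⟩ := Finset.mem_add.1 (MvPolynomial.support_mul p q ha)
    have h1 := hp u hu
    have h2 := hq v hv
    simp only [Finsupp.add_apply, mul_add, sum_add_distrib]
    rw [mul_one]
    exact add_le_add h1 h2

theorem edge_pow_deg (G : SimpleGraph (Fin N)) (t : ℕ) (p : MvPolynomial (Fin N) K)
    (hp : p ∈ edgeIdeal K G ^ t) (a : Fin N →₀ ℕ) (ha : a ∈ p.support) :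
    2 * t ≤ ∑ i, a i := by
  classical
  have h : edgeIdeal K G ≤ wtIdeal K (fun _ => 1) 2 := by
    rw [edgeIdeal, Ideal.span_le]
    rintro _ ⟨i, j, _, rfl⟩
    rw [SetLike.mem_coe, mem_wtIdeal]
    intro a ha
    have ha := MvPolynomial.support_mul _ _ ha
    rw [support_X, support_X] at ha
    simp at ha
    subst ha
    simp [sum_add_distrib, Finsupp.single_apply]
  have := wtIdeal_pow _ _ _ (Ideal.pow_right_mono h t hp) a ha
  simpa using this

theorem var_pow_wt (S : Finset (Fin N)) (t : ℕ) (p : MvPolynomial (Fin N) K)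
    (hp : p ∈ varIdeal K N S ^ t) (a : Fin N →₀ ℕ) (ha : a ∈ p.support) :
    t ≤ ∑ i ∈ S, a i := by
  classical
  have h : varIdeal K N S ≤ wtIdeal K (fun i => if i ∈ S then 1 else 0) 1 := by
    rw [varIdeal, Ideal.span_le]
    rintro _ ⟨i, hi, rfl⟩
    rw [SetLike.mem_coe, mem_wtIdeal]
    intro a ha
    simp only [support_X, mem_singleton] at ha
    subst ha
    have hi' : i ∈ S := hi
    simp [Finsupp.single_apply, hi']
  have := wtIdeal_pow _ _ _ (Ideal.pow_right_mono h t hp) a ha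
  simpa using this

theorem monomial_eq_prod (a : Fin N →₀ ℕ) :
    (monomial a (1 : K)) = ∏ i, (X i : MvPolynomial (Fin N) K) ^ a i := by
  rw [monomial_eq]
  simp [Finsupp.prod_fintype]

theorem monomial_mem_var_pow (S : Finset (Fin N)) (t : ℕ) (a : Fin N →₀ ℕ)
    (ha : t ≤ ∑ i ∈ S, a i) : (monomial a (1 : K)) ∈ varIdeal K N S ^ t := by
  classical
  rw [monomial_eq_prod, ← Finset.prod_mul_prod_compl S]
  apply Ideal.mul_mem_right
  refine Ideal.pow_le_pow_right ha ?_
  rw [← Finset.prod_pow_eq_pow_sum]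
  apply Ideal.prod_mem_prod
  intro i hi
  have hX : (X i : MvPolynomial (Fin N) K) ∈ varIdeal K N S :=
    Ideal.subset_span ⟨i, hi, rfl⟩
  exact Ideal.pow_mem_pow hX _

theorem exists_min_cover (G : SimpleGraph (Fin N)) (S : Finset (Fin N))
    (hS : IsVertexCover G S) : ∃ T ⊆ S, IsMinVertexCover G T := by
  induction S using Finset.strongInduction with
  | H S ih =>
    by_cases h : ∃ T, T ⊂ S ∧ IsVertexCover G T
    · obtain ⟨T, hT, hc⟩ := h
      obtain ⟨U, hU, hm⟩ := ih T hT hc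
      exact ⟨U, hU.trans hT.1, hm⟩
    · push Not at h
      exact ⟨S, subset_rfl, hS, h⟩

theorem cycle_adj (n : ℕ) (hn : 1 ≤ n) (i : Fin (2 * n + 1)) :
    (cycleGraph (2 * n + 1)).Adj i (i + 1) := by
  rw [cycleGraph, SimpleGraph.fromRel_adj]
  have h : ((i + 1 : Fin (2 * n + 1)) : ℕ) = ((i : ℕ) + 1) % (2 * n + 1) := by
    rw [Fin.val_add]
    congr 2
    rw [Fin.val_one']
    exact Nat.mod_eq_of_lt (by omega)
  refine ⟨fun e => ?_, Or.inl h⟩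
  rw [← e] at h
  have hi := i.2
  rcases Nat.lt_or_ge ((i : ℕ) + 1) (2 * n + 1) with h' | h'
  · rw [Nat.mod_eq_of_lt h'] at h; omega
  · have : (i : ℕ) + 1 = 2 * n + 1 := by omega
    rw [this, Nat.mod_self] at h; omega

theorem cover_card (n : ℕ) (hn : 1 ≤ n) (S : Finset (Fin (2 * n + 1)))
    (hS : IsVertexCover (cycleGraph (2 * n + 1)) S) : 2 * n + 2 ≤ 2 * S.card := by
  classical
  have h1 : ∑ i : Fin (2 * n + 1), (if i ∈ S then 1 else 0) = S.card := by simp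
  have h2 : ∑ i : Fin (2 * n + 1), (if i + 1 ∈ S then 1 else 0) = S.card := by
    rw [← h1]
    exact Equiv.sum_comp (Equiv.addRight (1 : Fin (2 * n + 1))) (fun i => if i ∈ S then 1 else 0)
  have h3 : ∑ i : Fin (2 * n + 1), 1 ≤ ∑ i : Fin (2 * n + 1),
      ((if i ∈ S then 1 else 0) + (if i + 1 ∈ S then 1 else 0)) := by
    apply sum_le_sum
    intro i _
    rcases hS (cycle_adj n hn i) with h | h <;> simp [h]
  rw [sum_add_distrib, h1, h2] at h3
  simp at h3
  omega

theorem key_lemma (n r : ℕ) (hn : 1 ≤ n) (a : Fin (2 * n + 1) →₀ ℕ)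
    (hdeg : 2 * r ≤ ∑ i, a i)
    (hcov : ∀ S, IsMinVertexCover (cycleGraph (2 * n + 1)) S → r ≤ ∑ i ∈ S, a i) :
    (monomial a (1 : K)) ∈ edgeIdeal K (cycleGraph (2 * n + 1)) ^ r := by
  classical
  let x : ℕ → MvPolynomial (Fin (2 * n + 1)) K := fun i => X (Fin.ofNat (2 * n + 1) i)
  let b : ℕ → ℕ := fun i => a (Fin.ofNat (2 * n + 1) i)
  have hof : ∀ i : Fin (2 * n + 1), Fin.ofNat (2 * n + 1) (i : ℕ) = i := by
    intro i; simp
  have hsucc : ∀ i : ℕ, Fin.ofNat (2 * n + 1) (i + 1) = Fin.ofNat (2 * n + 1) i + 1 := by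
    intro i; apply Fin.ext; simp [Fin.val_add]
  have hlast : Fin.ofNat (2 * n + 1) (2 * n) + 1 = Fin.ofNat (2 * n + 1) 0 := by
    rw [← hsucc]; apply Fin.ext; simp
  have hprod : (monomial a (1 : K)) = ∏ i ∈ range (2 * n + 1), x i ^ b i := by
    rw [monomial_eq_prod, ← Fin.prod_univ_eq_prod_range (fun i => x i ^ b i)]
    apply prod_congr rfl
    intro i _
    simp only [x, b, hof]
  rw [hprod]
  have hadj := cycle_adj n hn
  apply cycle_lemma x _ (2 * n) r (by omega)
  · intro i _
    exact Ideal.subset_span ⟨_, _, hadj (Fin.ofNat _ i), by simp only [x]; rw [hsucc]⟩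
  · refine Ideal.subset_span ⟨_, _, (hadj (Fin.ofNat _ (2 * n))).symm, ?_⟩
    simp only [x]; rw [hlast]
  · intro s hs hs0
    let S : Finset (Fin (2 * n + 1)) := univ.filter fun i => s i = true
    have hS : IsVertexCover (cycleGraph (2 * n + 1)) S := by
      have key : ∀ i j : Fin (2 * n + 1), (j : ℕ) = ((i : ℕ) + 1) % (2 * n + 1) →
          s i = true ∨ s j = true := by
        intro i j hij
        rcases Nat.lt_or_ge (i : ℕ) (2 * n) with h | h
        · rw [Nat.mod_eq_of_lt (by omega)] at hij
          rw [hij]; exact hs i h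
        · have hi : (i : ℕ) = 2 * n := by omega
          rw [hi, Nat.mod_self] at hij
          rw [hi, hij]; exact hs0
      intro i j hij
      rw [cycleGraph, SimpleGraph.fromRel_adj] at hij
      simp only [S, mem_filter, mem_univ, true_and]
      rcases hij.2 with h | h
      · exact key i j h
      · exact (key j i h).symm
    obtain ⟨T, hT, hTm⟩ := exists_min_cover _ S hS
    refine (hcov T hTm).trans ((sum_le_sum_of_subset hT).trans (le_of_eq ?_))
    rw [← Fin.sum_univ_eq_sum_range (fun i => if s i = true then b i else 0), sum_filter]
    apply sum_congr rfl
    intro i _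
    simp only [b, hof]
  · rw [← Fin.sum_univ_eq_sum_range b]
    refine hdeg.trans (le_of_eq (sum_congr rfl fun i _ => ?_))
    simp only [b, hof]

theorem exists_low (n m r : ℕ) (hn : 1 ≤ n)
    (h : ¬ symbolicPower K (cycleGraph (2 * n + 1)) m
        ≤ edgeIdeal K (cycleGraph (2 * n + 1)) ^ r) :
    ∃ a : Fin (2 * n + 1) →₀ ℕ, ∑ i, a i < 2 * r ∧
      ∀ S, IsMinVertexCover (cycleGraph (2 * n + 1)) S → m ≤ ∑ i ∈ S, a i := by
  classical
  rcases Nat.lt_or_ge m r with hmr | hmr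
  · refine ⟨Finsupp.single 0 m + Finsupp.single (0 + 1) m, ?_, ?_⟩
    · simp only [Finsupp.add_apply, sum_add_distrib, Finsupp.single_apply]
      simp
      omega
    · intro S hS
      simp only [Finsupp.add_apply, sum_add_distrib, Finsupp.single_apply]
      rcases hS.1 (cycle_adj n hn 0) with h' | h'
      · simp only [sum_ite_eq, h', if_true]; omega
      · simp only [sum_ite_eq, h', if_true]; omega
  · by_contra hcon
    push Not at hcon
    apply h
    intro p hp
    have hp' : ∀ S, IsMinVertexCover (cycleGraph (2 * n + 1)) S →
        p ∈ varIdeal K (2 * n + 1) S ^ m := by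
      simpa only [symbolicPower, Ideal.mem_iInf] using hp
    rw [p.as_sum]
    apply Ideal.sum_mem
    intro a ha
    have hw : ∀ S, IsMinVertexCover (cycleGraph (2 * n + 1)) S → m ≤ ∑ i ∈ S, a i :=
      fun S hS => var_pow_wt S m p (hp' S hS) a ha
    have hd : 2 * r ≤ ∑ i, a i := by
      by_contra hlt
      push Not at hlt
      obtain ⟨S, hS, hS'⟩ := hcon a hlt
      exact absurd (hw S hS) (by omega)
    have := key_lemma (K := K) n r hn a hd fun S hS => hmr.trans (hw S hS)
    have e : monomial a (coeff a p) = C (coeff a p) * monomial a 1 := by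
      rw [C_mul_monomial, mul_one]
    rw [e]
    exact Ideal.mul_mem_left _ _ this

end Weights

/-- For the edge ideal of an odd cycle, if `I^(m) ⊄ I^r`, then
`I^(m + 2n + 2) ⊄ I^{r + 2n + 1}`. -/
theorem not_le_step (K : Type*) [Field K] (n m r : ℕ)
    (hn : 1 ≤ n) (hm : 1 ≤ m) (hr : 1 ≤ r)
    (h : ¬ symbolicPower K (cycleGraph (2 * n + 1)) m
        ≤ edgeIdeal K (cycleGraph (2 * n + 1)) ^ r) :
    ¬ symbolicPower K (cycleGraph (2 * n + 1)) (m + (2 * n + 2))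
        ≤ edgeIdeal K (cycleGraph (2 * n + 1)) ^ (r + (2 * n + 1)) := by
  classical
  obtain ⟨a, hlt, hw⟩ := exists_low n m r hn h
  intro hle
  let b : Fin (2 * n + 1) →₀ ℕ := a + Finsupp.equivFunOnFinite.symm (fun _ => 2)
  have hmem : (monomial b (1 : K)) ∈
      symbolicPower K (cycleGraph (2 * n + 1)) (m + (2 * n + 2)) := by
    simp only [symbolicPower, Ideal.mem_iInf]
    intro S hS
    apply monomial_mem_var_pow
    have h1 := hw S hS
    have h2 := cover_card n hn S hS.1
    simp only [b, Finsupp.add_apply, Finset.sum_add_distrib, Finsupp.equivFunOnFinite_symm_apply_apply]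
    simp only [Finset.sum_const, smul_eq_mul]
    omega
  have := edge_pow_deg _ _ _ (hle hmem) b (by simp [mem_support_iff])
  simp only [b, Finsupp.add_apply, Finset.sum_add_distrib, Finsupp.equivFunOnFinite_symm_apply_apply] at this
  simp at this
  omega
end
end
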